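/- For every percolation configuration ω with 0 ∈ C and all integers n ≥ 1 and m ≥ 1: (P_0^ω(N_n = m))^2 ≤ 2d (2m+1)^d · P_0^ω(N_{2n} ≤ 2m and X_{2n} = 0). -/

import Mathlib

open MeasureTheory
open scoped ENNReal

namespace Perco

/-- Vertices of the lattice `Z^d`. -/
abbrev Zd (d : ℕ) := Fin d → ℤ

/-- A percolation configuration: each (unordered) edge of the lattice is open or closed.
(Only the values on nearest-neighbour pairs matter.) -/
abbrev Config (d : ℕ) := Sym2 (Zd d) → Bool

/-- Lattice adjacency: `(x,y) ∈ E^d`. -/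
def latAdj {d : ℕ} (x y : Zd d) : Prop := (∑ i, |x i - y i|) = 1

/-- Open adjacency in the configuration `ω`. -/
def openAdj {d : ℕ} (ω : Config d) (x y : Zd d) : Prop :=
  latAdj x y ∧ ω s(x, y) = true

/-- `C`: the open cluster of the origin. -/
def cluster {d : ℕ} (ω : Config d) : Set (Zd d) :=
  {y | Relation.ReflTransGen (openAdj ω) 0 y}

/-- `Q` is the product measure making the edge states i.i.d. Bernoulli(p). -/
def IsBernoulli {d : ℕ} (p : ℝ) (Q : Measure (Config d)) : Prop :=
  IsProbabilityMeasure Q ∧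
    ∀ (s : Finset (Sym2 (Zd d))) (f : Sym2 (Zd d) → Bool),
      Q {ω : Config d | ∀ e ∈ s, ω e = f e} =
        ∏ e ∈ s, (if f e then ENNReal.ofReal p else ENNReal.ofReal (1 - p))

/-- The critical probability `p_c`. -/
noncomputable def pc (d : ℕ) : ℝ :=
  sSup {p : ℝ | 0 ≤ p ∧ p ≤ 1 ∧
    ∀ Q : Measure (Config d), IsBernoulli p Q → Q {ω | (cluster ω).Infinite} = 0}

/-- The box `B_n = [-n,n]^d`. -/
def box (d n : ℕ) : Set (Zd d) := {x | ∀ i, |x i| ≤ (n : ℤ)}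

/-- `C_n`: the connected component of `0` in `C ∩ B_n`. -/
def clusterN {d : ℕ} (ω : Config d) (n : ℕ) : Set (Zd d) :=
  {y | Relation.ReflTransGen
    (fun a b => openAdj ω a b ∧ a ∈ box d n ∧ b ∈ box d n) 0 y}

/-- `A` is connected in the open subgraph. -/
def ConnOpen {d : ℕ} (ω : Config d) (A : Set (Zd d)) : Prop :=
  ∀ x ∈ A, ∀ y ∈ A,
    Relation.ReflTransGen (fun a b => openAdj ω a b ∧ a ∈ A ∧ b ∈ A) x y

/-- `A` is connected in the lattice. -/
def ConnLat {d : ℕ} (A : Set (Zd d)) : Prop :=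
  ∀ x ∈ A, ∀ y ∈ A,
    Relation.ReflTransGen (fun a b => latAdj a b ∧ a ∈ A ∧ b ∈ A) x y

/-- The boundary `∂_{C^g} A` = open lattice edges from `A` to its complement. -/
def bdry {d : ℕ} (ω : Config d) (A : Set (Zd d)) : Set (Zd d × Zd d) :=
  {e | openAdj ω e.1 e.2 ∧ e.1 ∈ A ∧ e.2 ∉ A}

/-- The profile `f_c` (at scale `n`, exponent `γ`). -/
noncomputable def fcut (d : ℕ) (γ c : ℝ) (n : ℕ) (x : ℝ) : ℝ :=
  if x < c * (n : ℝ) ^ γ then 1 else x ^ (1 - 1 / (d : ℝ))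

/-- `ν(x)`: number of open neighbours of `x`. -/
noncomputable def nu {d : ℕ} (ω : Config d) (x : Zd d) : ℕ :=
  Set.ncard {y | openAdj ω x y}

-- Transition kernel of the simple random walk on the open subgraph.
open Classical in
noncomputable def step {d : ℕ} (ω : Config d) (x y : Zd d) : ℝ :=
  if openAdj ω x y then ((nu ω x : ℝ))⁻¹ else 0

/-- Weight of a path of length `n`. -/
noncomputable def pathW {d n : ℕ} (ω : Config d) (γ : Fin (n + 1) → Zd d) : ℝ :=
  ∏ i : Fin n, step ω (γ i.castSucc) (γ i.succ)

/-- `N_n`: number of distinct sites visited by the path. -/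
noncomputable def visits {d n : ℕ} (γ : Fin (n + 1) → Zd d) : ℕ :=
  (Set.range γ).ncard

/-- `P_0^ω(E)`, the probability of a path event for the walk started at 0. -/
noncomputable def PWalk {d : ℕ} (ω : Config d) (n : ℕ)
    (E : (Fin (n + 1) → Zd d) → Prop) : ℝ :=
  ∑' γ : Fin (n + 1) → Zd d,
    Set.indicator {γ | γ 0 = 0 ∧ E γ} (fun γ => pathW ω γ) γ

/-- `E_0^ω(α^{N_n})`. -/
noncomputable def LaplaceN {d : ℕ} (ω : Config d) (α : ℝ) (n : ℕ) : ℝ :=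
  ∑' γ : Fin (n + 1) → Zd d,
    Set.indicator {γ | γ 0 = 0} (fun γ => pathW ω γ * α ^ visits γ) γ

/-- `E_0^ω(α^{N_n} 1_{X_n = 0})`. -/
noncomputable def LaplaceNReturn {d : ℕ} (ω : Config d) (α : ℝ) (n : ℕ) : ℝ :=
  ∑' γ : Fin (n + 1) → Zd d,
    Set.indicator {γ | γ 0 = 0 ∧ γ (Fin.last n) = 0}
      (fun γ => pathW ω γ * α ^ visits γ) γ

/-- Vertices of the wreath product `C^g ≀ Z/2Z` (lamplighter states). -/
abbrev Lamp (d : ℕ) := Zd d × (Zd d →₀ ZMod 2)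

/-- Flip a lamp configuration at one point. -/
noncomputable def flipAt {σ : Type*} (f : σ →₀ ZMod 2) (x : σ) : σ →₀ ZMod 2 :=
  f + Finsupp.single x 1

/-- Transition kernel of the lamplighter walk `Z` with parameter `α`. -/
noncomputable def ptilde {d : ℕ} (ω : Config d) (α : ℝ) (u v : Lamp d) : ℝ :=
  Set.indicator
    {q : Lamp d × Lamp d | ∀ x, x ≠ q.1.1 → x ≠ q.2.1 → q.1.2 x = q.2.2 x}
    (fun q => (if q.2.2 q.1.1 = 0 then α else 1 - α) *
      (if q.2.2 q.2.1 = 0 then α else 1 - α) * step ω q.1.1 q.2.1) (u, v)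

/-- `P̃_o^ω(Z_n = o)`: return probability of the lamplighter walk. -/
noncomputable def ZReturn {d : ℕ} (ω : Config d) (α : ℝ) (n : ℕ) : ℝ :=
  ∑' γ : Fin (n + 1) → Lamp d,
    Set.indicator {γ | γ 0 = (0, 0) ∧ γ (Fin.last n) = (0, 0)}
      (fun γ => ∏ i : Fin n, ptilde ω α (γ i.castSucc) (γ i.succ)) γ

/-- Vertex set of the wreath product over a vertex set `V` of the base. -/
def wVert {d : ℕ} (V : Set (Zd d)) : Set (Lamp d) :=
  {u | u.1 ∈ V ∧ ↑u.2.support ⊆ V}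

/-- Adjacency in the wreath product `C^g ≀ Z/2Z`. -/
def wAdj {d : ℕ} (ω : Config d) (u v : Lamp d) : Prop :=
  (u.1 = v.1 ∧ (∀ x, x ≠ u.1 → u.2 x = v.2 x) ∧ u.2 u.1 ≠ v.2 u.1) ∨
    (u.2 = v.2 ∧ openAdj ω u.1 v.1)

/-- Boundary of `U` in the wreath product `C^g ≀ Z/2Z`. -/
def wBdry {d : ℕ} (ω : Config d) (U : Set (Lamp d)) : Set (Lamp d × Lamp d) :=
  {e | e.1 ∈ U ∧ e.2 ∈ wVert (cluster ω) \ U ∧ wAdj ω e.1 e.2}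

/-- Følner function `Fol_{C_n^g}^{C^g}` (with value `⊤` when no set qualifies). -/
noncomputable def FolC {d : ℕ} (ω : Config d) (n : ℕ) (k : ℝ) : ℝ≥0∞ :=
  sInf {m : ℝ≥0∞ | ∃ A : Set (Zd d), A ⊆ clusterN ω n ∧ A.Nonempty ∧
    ((bdry ω A).ncard : ℝ) / (A.ncard : ℝ) ≤ 1 / k ∧ m = (A.ncard : ℝ≥0∞)}

/-- Følner function `Fol_{C_n^g ≀ Z/2Z}^{C^g ≀ Z/2Z}`. -/
noncomputable def FolW {d : ℕ} (ω : Config d) (n : ℕ) (k : ℝ) : ℝ≥0∞ :=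
  sInf {m : ℝ≥0∞ | ∃ U : Set (Lamp d), U ⊆ wVert (clusterN ω n) ∧ U.Nonempty ∧
    ((wBdry ω U).ncard : ℝ) / (U.ncard : ℝ) ≤ 1 / k ∧ m = (U.ncard : ℝ≥0∞)}

/-- Degree of a configuration `f` in the graph `K_U`. -/
noncomputable def Kdeg {d : ℕ} (U : Set (Lamp d)) (f : Zd d →₀ ZMod 2) : ℕ :=
  Set.ncard {g : Zd d →₀ ZMod 2 | ∃ x : Zd d, (x, f) ∈ U ∧ (x, g) ∈ U ∧ g = flipAt f x}

/-- A point `u = (x,f)` of `U` is bad if `(x, f̄_x) ∉ U`. -/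
def badPt {d : ℕ} (U : Set (Lamp d)) (u : Lamp d) : Prop :=
  (u.1, flipAt u.2 u.1) ∉ U

/-- `D(0,x) ≤ r`: the chemical distance from the origin to `x` is at most `r`. -/
def chemLE {d : ℕ} (ω : Config d) (x : Zd d) (r : ℕ) : Prop :=
  ∃ m ≤ r, ∃ γ : ℕ → Zd d, γ 0 = 0 ∧ γ m = x ∧ ∀ i < m, openAdj ω (γ i) (γ (i + 1))

/-- `B_r(C)`: chemical ball of radius `r` around the origin. -/
def chemBall {d : ℕ} (ω : Config d) (r : ℕ) : Set (Zd d) := {x | chemLE ω x r}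

/-- Lattice connected component of `x` inside a vertex set `V`. -/
def latCompIn {d : ℕ} (V : Set (Zd d)) (x : Zd d) : Set (Zd d) :=
  {y | Relation.ReflTransGen (fun a b => latAdj a b ∧ a ∈ V ∧ b ∈ V) x y}

/-- Open connected component of `x` inside a vertex set `V`. -/
def openCompIn {d : ℕ} (ω : Config d) (V : Set (Zd d)) (x : Zd d) : Set (Zd d) :=
  {y | Relation.ReflTransGen (fun a b => openAdj ω a b ∧ a ∈ V ∧ b ∈ V) x y}

/-- `L_n`: a connected component of the open subgraph inside `B_n` of maximal cardinality. -/
def IsLargestComp {d : ℕ} (ω : Config d) (n : ℕ) (L : Set (Zd d)) : Prop :=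
  (∃ x ∈ box d n, L = openCompIn ω (box d n) x) ∧
    ∀ y ∈ box d n, (openCompIn ω (box d n) y).ncard ≤ L.ncard

/-- `\bar L`: the connected component of `L` in the full open subgraph. -/
def closureOf {d : ℕ} (ω : Config d) (L : Set (Zd d)) : Set (Zd d) :=
  {y | ∃ x ∈ L, Relation.ReflTransGen (openAdj ω) x y}

/-- The boundary `∂_{\bar L_n^g} A`. -/
def bdryBar {d : ℕ} (ω : Config d) (n : ℕ) (L A : Set (Zd d)) : Set (Zd d × Zd d) :=
  {e | openAdj ω e.1 e.2 ∧ e.1 ∈ A ∩ closureOf ω L ∧ e.2 ∈ box d (n + 1) \ A}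

/-- `n(A)`: number of connected components of `B_n − L` containing a component of `A`. -/
noncomputable def nComp {d : ℕ} (n : ℕ) (L A : Set (Zd d)) : ℕ :=
  Set.ncard {P : Set (Zd d) |
    (∃ x ∈ box d n \ L, P = latCompIn (box d n \ L) x) ∧
    ∃ x ∈ A, latCompIn A x ⊆ P}

/-- The killed kernel `P^{B_r(C)}` acting on functions. -/
noncomputable def Pball {d : ℕ} (ω : Config d) (r : ℕ) (f : Zd d → ℝ) : Zd d → ℝ :=
  Set.indicator (chemBall ω r) (fun x =>
    ∑' y : Zd d, Set.indicator (chemBall ω r) (fun y => step ω x y * f y) y)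

/-- The Dirichlet form `ξ(f,f) = ((Id − P^{B_r(C)}) 1_{B_r(C)} f | f)_ν`. -/
noncomputable def dirichletForm {d : ℕ} (ω : Config d) (r : ℕ) (f : Zd d → ℝ) : ℝ :=
  ∑' x : Zd d, (nu ω x : ℝ) * f x *
    (Set.indicator (chemBall ω r) f x - Pball ω r (Set.indicator (chemBall ω r) f) x)

/-- `‖f‖²_{l²(ν)}`. -/
noncomputable def normSq {d : ℕ} (ω : Config d) (f : Zd d → ℝ) : ℝ :=
  ∑' x : Zd d, (nu ω x : ℝ) * f x ^ 2

/-- `λ_1(B_r(C))`: smallest Dirichlet eigenvalue of the killed walk. -/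
noncomputable def lambda1 {d : ℕ} (ω : Config d) (r : ℕ) : ℝ :=
  sInf {t : ℝ | ∃ f : Zd d → ℝ, f ≠ 0 ∧ Function.support f ⊆ chemBall ω r ∧
    t = dirichletForm ω r f / normSq ω f}

lemma openAdj_symm {d : ℕ} {ω : Config d} {x y : Zd d} (h : openAdj ω x y) :
    openAdj ω y x := by
  refine ⟨?_, Sym2.eq_swap ▸ h.2⟩
  have h1 := h.1
  unfold latAdj at h1 ⊢
  simpa only [abs_sub_comm] using h1

lemma abs_sub_le_one_of_latAdj {d : ℕ} {x y : Zd d} (h : latAdj x y) (j : Fin d) :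
    |x j - y j| ≤ 1 := by
  unfold latAdj at h
  rw [← h]
  exact Finset.single_le_sum (f := fun i => |x i - y i|) (fun i _ => abs_nonneg _)
    (Finset.mem_univ j)

lemma setOf_latAdj_subset {d : ℕ} (x : Zd d) :
    {y | latAdj x y} ⊆ (((Finset.univ : Finset (Fin d)) ×ˢ ({1, -1} : Finset ℤ)).image
      (fun p => Function.update x p.1 (x p.1 + p.2)) : Finset (Zd d)) := by
  intro y hy
  have hy' : (∑ i, |x i - y i|) = 1 := hy
  obtain ⟨i, hi⟩ : ∃ i, x i ≠ y i := by
    by_contra! h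
    simp [h] at hy'
  rw [← Finset.add_sum_erase _ _ (Finset.mem_univ i)] at hy'
  have hpos : 0 < |x i - y i| := abs_pos.mpr (sub_ne_zero.mpr hi)
  have hnn : 0 ≤ ∑ k ∈ Finset.univ.erase i, |x k - y k| :=
    Finset.sum_nonneg fun _ _ => abs_nonneg _
  have hz : ∑ k ∈ Finset.univ.erase i, |x k - y k| = 0 := by omega
  have h1 : |x i - y i| = 1 := by omega
  rw [Finset.sum_eq_zero_iff_of_nonneg fun _ _ => abs_nonneg _] at hz
  simp only [Finset.coe_image, Set.mem_image, Finset.mem_coe, Finset.mem_product,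
    Finset.mem_univ, true_and, Prod.exists]
  refine ⟨i, y i - x i, ?_, ?_⟩
  · simp only [Finset.mem_insert, Finset.mem_singleton]
    rcases (abs_eq zero_le_one).mp h1 with h | h <;> omega
  · funext k
    by_cases hk : k = i
    · subst hk; simp
    · have := hz k (Finset.mem_erase.mpr ⟨hk, Finset.mem_univ k⟩)
      rw [Function.update_of_ne hk]
      exact sub_eq_zero.mp (abs_eq_zero.mp this)

lemma finite_setOf_openAdj {d : ℕ} (ω : Config d) (x : Zd d) : {y | openAdj ω x y}.Finite :=
  (Finset.finite_toSet _).subset fun _ hy => setOf_latAdj_subset x hy.1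

lemma nu_le {d : ℕ} (ω : Config d) (x : Zd d) : nu ω x ≤ 2 * d := by
  refine (Set.ncard_le_ncard (fun _ hy => setOf_latAdj_subset x hy.1)
    (Finset.finite_toSet _)).trans ?_
  rw [Set.ncard_coe_finset]
  refine Finset.card_image_le.trans ?_
  rw [Finset.card_product]
  simp [mul_comm]

lemma nu_pos {d : ℕ} {ω : Config d} {x y : Zd d} (h : openAdj ω x y) : 0 < nu ω x :=
  (Set.ncard_pos (finite_setOf_openAdj ω x)).mpr ⟨y, h⟩

lemma step_nonneg {d : ℕ} (ω : Config d) (x y : Zd d) : 0 ≤ step ω x y := by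
  unfold step
  split_ifs <;> positivity

lemma openAdj_of_step_ne_zero {d : ℕ} {ω : Config d} {x y : Zd d} (h : step ω x y ≠ 0) :
    openAdj ω x y := by
  by_contra hclosed
  exact h (if_neg hclosed)

/-- Detailed balance for the simple random walk. -/
lemma nu_mul_step {d : ℕ} (ω : Config d) (x y : Zd d) :
    (nu ω x : ℝ) * step ω x y = nu ω y * step ω y x := by
  by_cases h : openAdj ω x y
  · have h' := openAdj_symm h
    have h1 : (nu ω x : ℝ) ≠ 0 := by exact_mod_cast (nu_pos h).ne'
    have h2 : (nu ω y : ℝ) ≠ 0 := by exact_mod_cast (nu_pos h').ne'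
    simp [step, h, h', h1, h2]
  · have h' : ¬ openAdj ω y x := fun h' => h (openAdj_symm h')
    simp [step, h, h']

lemma nu_mul_prod_step {d : ℕ} (ω : Config d) (g : ℕ → Zd d) (n : ℕ) :
    (nu ω (g 0) : ℝ) * ∏ k ∈ Finset.range n, step ω (g k) (g (k + 1)) =
      nu ω (g n) * ∏ k ∈ Finset.range n, step ω (g (k + 1)) (g k) := by
  induction n with
  | zero => simp
  | succ n ih =>
    rw [Finset.prod_range_succ, Finset.prod_range_succ, ← mul_assoc, ih, mul_right_comm,
      nu_mul_step]
    ring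

lemma pathW_nonneg {d n : ℕ} (ω : Config d) (γ : Fin (n + 1) → Zd d) : 0 ≤ pathW ω γ :=
  Finset.prod_nonneg fun _ _ => step_nonneg _ _ _

/-- Extension of a path to all times, constant after its final time. -/
def extendPath {d n : ℕ} (γ : Fin (n + 1) → Zd d) (k : ℕ) : Zd d :=
  γ ⟨min k n, by omega⟩

lemma extendPath_val {d n : ℕ} (γ : Fin (n + 1) → Zd d) (i : Fin (n + 1)) :
    extendPath γ i = γ i := by
  unfold extendPath
  congr 1
  ext
  simp only
  omega

lemma extendPath_of_le {d n : ℕ} (γ : Fin (n + 1) → Zd d) {k : ℕ} (hk : k ≤ n) :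
    extendPath γ k = γ ⟨k, by omega⟩ :=
  extendPath_val γ ⟨k, by omega⟩

lemma pathW_eq_prod_range {d n : ℕ} (ω : Config d) (γ : Fin (n + 1) → Zd d) :
    pathW ω γ = ∏ k ∈ Finset.range n, step ω (extendPath γ k) (extendPath γ (k + 1)) := by
  rw [← Fin.prod_univ_eq_prod_range
    (fun k => step ω (extendPath γ k) (extendPath γ (k + 1))) n]
  refine Finset.prod_congr rfl fun i _ => ?_
  rw [← extendPath_val γ i.castSucc, ← extendPath_val γ i.succ]
  rfl

lemma openAdj_of_pathW_ne_zero {d n : ℕ} {ω : Config d} {γ : Fin (n + 1) → Zd d}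
    (h : pathW ω γ ≠ 0) {k : ℕ} (hk : k < n) :
    openAdj ω (extendPath γ k) (extendPath γ (k + 1)) := by
  rw [pathW_eq_prod_range] at h
  exact openAdj_of_step_ne_zero (Finset.prod_ne_zero_iff.mp h k (Finset.mem_range.mpr hk))

/-- A path of unit coordinate increments from the origin takes all intermediate values. -/
lemma exists_eq_of_mem_uIcc {n : ℕ} (f : ℕ → ℤ) (h0 : f 0 = 0)
    (hf : ∀ k < n, |f k - f (k + 1)| ≤ 1) {k : ℕ} (hk : k ≤ n) {z : ℤ}
    (hz : z ∈ Finset.uIcc 0 (f k)) : ∃ i ≤ k, f i = z := by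
  induction k with
  | zero => exact ⟨0, le_rfl, by simp_all⟩
  | succ k ih =>
    by_cases hz' : z ∈ Finset.uIcc 0 (f k)
    · obtain ⟨i, hi, e⟩ := ih (by omega) hz'
      exact ⟨i, by omega, e⟩
    · refine ⟨k + 1, le_rfl, ?_⟩
      have := abs_le.mp (hf k (by omega))
      rw [Finset.mem_uIcc] at hz hz'
      omega

lemma abs_le_visits {d n : ℕ} {ω : Config d} {γ : Fin (n + 1) → Zd d} (h0 : γ 0 = 0)
    (h : pathW ω γ ≠ 0) (i : Fin (n + 1)) (j : Fin d) : |γ i j| ≤ (visits γ : ℤ) := by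
  have hsub : ((Finset.uIcc 0 (γ i j) : Finset ℤ) : Set ℤ) ⊆
      (fun x : Zd d => x j) '' Set.range γ := by
    intro z hz
    have h00 : extendPath γ 0 = 0 := by rw [← h0]; exact extendPath_val γ 0
    obtain ⟨k, -, hk⟩ := exists_eq_of_mem_uIcc (n := n) (fun k => extendPath γ k j)
      (by simp [h00])
      (fun k hk => abs_sub_le_one_of_latAdj (openAdj_of_pathW_ne_zero h hk).1 j)
      (k := i) (by omega) (z := z) (by rw [extendPath_val]; exact hz)
    exact ⟨_, ⟨_, rfl⟩, hk⟩
  have hcard := (Set.ncard_le_ncard hsub ((Set.finite_range γ).image _)).trans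
    (Set.ncard_image_le (Set.finite_range γ))
  rw [Set.ncard_coe_finset, Int.card_uIcc] at hcard
  change _ ≤ visits γ at hcard
  rw [Int.abs_eq_natAbs]
  omega

lemma visits_le {d n : ℕ} (γ : Fin (n + 1) → Zd d) : visits γ ≤ n + 1 := by
  unfold visits
  rw [← Set.image_univ]
  refine (Set.ncard_image_le Set.finite_univ).trans ?_
  simp [Set.ncard_univ]

/-- Only finitely many paths from the origin carry positive weight. -/
lemma finite_setOf_pathW_ne_zero {d : ℕ} (ω : Config d) (n : ℕ) :
    {γ : Fin (n + 1) → Zd d | γ 0 = 0 ∧ pathW ω γ ≠ 0}.Finite := by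
  refine (Set.Finite.pi' fun _ : Fin (n + 1) => Set.Finite.pi' fun _ : Fin d =>
    Set.finite_Icc (-((n : ℤ) + 1)) ((n : ℤ) + 1)).subset ?_
  rintro γ ⟨h0, h⟩ i j
  have h1 := abs_le_visits h0 h i j
  have h2 := visits_le γ
  exact abs_le.mp (by omega)

/-- Follow `γ`, then the time reversal of `γ'`. -/
def foldPath {d n : ℕ} (γ γ' : Fin (n + 1) → Zd d) (i : Fin (2 * n + 1)) : Zd d :=
  if (i : ℕ) ≤ n then extendPath γ i else extendPath γ' (2 * n - i)

lemma extendPath_foldPath_left {d n : ℕ} (γ γ' : Fin (n + 1) → Zd d) {k : ℕ} (hk : k ≤ n) :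
    extendPath (foldPath γ γ') k = extendPath γ k := by
  rw [extendPath_of_le _ (by omega)]
  exact if_pos hk

lemma extendPath_foldPath_right {d n : ℕ} {γ γ' : Fin (n + 1) → Zd d}
    (h : γ (Fin.last n) = γ' (Fin.last n)) {k : ℕ} (hk : k ≤ n) :
    extendPath (foldPath γ γ') (n + k) = extendPath γ' (n - k) := by
  rw [extendPath_of_le _ (by omega)]
  rcases Nat.eq_zero_or_pos k with rfl | hpos
  · have h1 := extendPath_val γ (Fin.last n)
    have h2 := extendPath_val γ' (Fin.last n)
    simp only [Fin.val_last] at h1 h2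
    simp [foldPath, h1, h2, h]
  · have : ¬ n + k ≤ n := by omega
    simp only [foldPath, this, if_false]
    congr 1
    omega

lemma foldPath_zero {d n : ℕ} (γ γ' : Fin (n + 1) → Zd d) : foldPath γ γ' 0 = γ 0 := by
  have := extendPath_val γ 0
  simpa [foldPath] using this

lemma foldPath_last {d n : ℕ} {γ γ' : Fin (n + 1) → Zd d}
    (h : γ (Fin.last n) = γ' (Fin.last n)) :
    foldPath γ γ' (Fin.last (2 * n)) = γ' 0 := by
  have h1 := extendPath_val (foldPath γ γ') (Fin.last (2 * n))
  have h2 := extendPath_foldPath_right h le_rfl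
  rw [Nat.sub_self, ← two_mul] at h2
  rw [Fin.val_last, h2] at h1
  exact h1.symm.trans (extendPath_val γ' 0)

lemma visits_foldPath_le {d n : ℕ} (γ γ' : Fin (n + 1) → Zd d) :
    visits (foldPath γ γ') ≤ visits γ + visits γ' := by
  unfold visits
  refine (Set.ncard_le_ncard ?_ ((Set.finite_range γ).union (Set.finite_range γ'))).trans
    (Set.ncard_union_le _ _)
  rintro _ ⟨i, rfl⟩
  unfold foldPath
  split_ifs
  · exact Or.inl ⟨_, rfl⟩
  · exact Or.inr ⟨_, rfl⟩

lemma foldPath_injective {d n : ℕ} {γ₁ γ₁' γ₂ γ₂' : Fin (n + 1) → Zd d}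
    (h₁ : γ₁ (Fin.last n) = γ₁' (Fin.last n)) (h₂ : γ₂ (Fin.last n) = γ₂' (Fin.last n))
    (h : foldPath γ₁ γ₁' = foldPath γ₂ γ₂') : γ₁ = γ₂ ∧ γ₁' = γ₂' := by
  constructor
  · funext i
    rw [← extendPath_val γ₁, ← extendPath_val γ₂,
      ← extendPath_foldPath_left γ₁ γ₁' (by omega), ← extendPath_foldPath_left γ₂ γ₂' (by omega),
      h]
  · funext i
    have e : (i : ℕ) = n - (n - i) := by omega
    rw [← extendPath_val γ₁', ← extendPath_val γ₂', e,
      ← extendPath_foldPath_right h₁ (by omega), ← extendPath_foldPath_right h₂ (by omega), h]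

lemma pathW_foldPath {d n : ℕ} (ω : Config d) {γ γ' : Fin (n + 1) → Zd d}
    (h : γ (Fin.last n) = γ' (Fin.last n)) :
    pathW ω (foldPath γ γ') = pathW ω γ *
      ∏ k ∈ Finset.range n, step ω (extendPath γ' (k + 1)) (extendPath γ' k) := by
  rw [pathW_eq_prod_range, congrArg Finset.range (two_mul n), Finset.prod_range_add,
    pathW_eq_prod_range]
  congr 1
  · refine Finset.prod_congr rfl fun k hk => ?_
    have hk := Finset.mem_range.mp hk
    rw [extendPath_foldPath_left _ _ (by omega), extendPath_foldPath_left _ _ (by omega)]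
  · rw [← Finset.prod_range_reflect]
    refine Finset.prod_congr rfl fun k hk => ?_
    have hk := Finset.mem_range.mp hk
    rw [add_assoc, extendPath_foldPath_right h (by omega),
      extendPath_foldPath_right h (by omega)]
    congr 2 <;> omega

lemma pathW_mul_pathW_le {d n : ℕ} (ω : Config d) (hn : 1 ≤ n) {γ γ' : Fin (n + 1) → Zd d}
    (h : γ (Fin.last n) = γ' (Fin.last n)) :
    pathW ω γ * pathW ω γ' ≤ 2 * d * pathW ω (foldPath γ γ') := by
  rw [pathW_foldPath ω h, mul_left_comm]
  refine mul_le_mul_of_nonneg_left ?_ (pathW_nonneg ω γ)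
  set R := ∏ k ∈ Finset.range n, step ω (extendPath γ' (k + 1)) (extendPath γ' k) with hR
  have hR0 : 0 ≤ R := Finset.prod_nonneg fun _ _ => step_nonneg _ _ _
  by_cases hw : pathW ω γ' = 0
  · rw [hw]; positivity
  have h1 : (1 : ℝ) ≤ nu ω (extendPath γ' 0) := by
    exact_mod_cast nu_pos (openAdj_of_pathW_ne_zero hw (k := 0) (by omega))
  have h2 : (nu ω (extendPath γ' n) : ℝ) ≤ 2 * d := by exact_mod_cast nu_le ω _
  calc pathW ω γ' ≤ nu ω (extendPath γ' 0) * pathW ω γ' :=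
        le_mul_of_one_le_left (pathW_nonneg ω γ') h1
    _ = nu ω (extendPath γ' n) * R := by rw [pathW_eq_prod_range, nu_mul_prod_step]
    _ ≤ 2 * d * R := mul_le_mul_of_nonneg_right h2 hR0

lemma support_indicator_pathW_subset {d : ℕ} (ω : Config d) (n : ℕ)
    (E : (Fin (n + 1) → Zd d) → Prop) :
    Function.support (Set.indicator {γ | γ 0 = 0 ∧ E γ} fun γ => pathW ω γ) ⊆
      {γ | γ 0 = 0 ∧ pathW ω γ ≠ 0} := by
  intro γ hγ
  rw [Set.support_indicator] at hγ
  exact ⟨hγ.1.1, hγ.2⟩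

lemma sum_pathW_le_PWalk {d n : ℕ} (ω : Config d) (E : (Fin (n + 1) → Zd d) → Prop)
    (T : Finset (Fin (n + 1) → Zd d)) (hT : ∀ γ ∈ T, γ 0 = 0 ∧ E γ) :
    ∑ γ ∈ T, pathW ω γ ≤ PWalk ω n E := by
  have hs : Summable (Set.indicator {γ | γ 0 = 0 ∧ E γ} fun γ => pathW ω γ) :=
    summable_of_hasFiniteSupport
      ((finite_setOf_pathW_ne_zero ω n).subset (support_indicator_pathW_subset ω n E))
  refine le_trans (le_of_eq ?_) (hs.sum_le_tsum T fun γ _ =>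
    Set.indicator_nonneg (fun γ _ => pathW_nonneg ω γ) γ)
  exact Finset.sum_congr rfl fun γ hγ => 
    (Set.indicator_of_mem (s := {γ | γ 0 = 0 ∧ E γ}) (hT γ hγ) _).symm

lemma PWalk_eq_sum {d n : ℕ} (ω : Config d) (E : (Fin (n + 1) → Zd d) → Prop)
    [DecidablePred E] :
    PWalk ω n E = ∑ γ ∈ (finite_setOf_pathW_ne_zero ω n).toFinset with E γ, pathW ω γ := by
  unfold PWalk
  rw [tsum_eq_sum (s := (finite_setOf_pathW_ne_zero ω n).toFinset) (fun γ hγ => ?_),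
    Finset.sum_filter]
  · refine Finset.sum_congr rfl fun γ hγ => ?_
    rw [Set.Finite.mem_toFinset] at hγ
    simp [Set.indicator_apply, hγ.1]
  · by_contra h
    exact hγ ((Set.Finite.mem_toFinset _).mpr (support_indicator_pathW_subset ω n E h))

/-- Cauchy–Schwarz over the fibres of a map. -/
lemma sq_sum_le_card_mul_sum_fiber {α β : Type*} [DecidableEq β] (S : Finset α)
    (B : Finset β) (e : α → β) (he : ∀ a ∈ S, e a ∈ B) (f : α → ℝ) :
    (∑ a ∈ S, f a) ^ 2 ≤
      (B.card : ℝ) * ∑ p ∈ S ×ˢ S with e p.1 = e p.2, f p.1 * f p.2 := by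
  rw [← Finset.sum_fiberwise_of_maps_to he]
  refine sq_sum_le_card_mul_sum_sq.trans_eq ?_
  congr 1
  rw [← Finset.sum_fiberwise_of_maps_to (s := {p ∈ S ×ˢ S | e p.1 = e p.2}) (t := B)
    (g := fun p => e p.1) (by
      intro p hp
      simp only [Finset.mem_filter, Finset.mem_product] at hp
      exact he _ hp.1.1)]
  refine Finset.sum_congr rfl fun x _ => ?_
  rw [sq, Finset.sum_mul_sum, ← Finset.sum_product']
  refine Finset.sum_congr ?_ fun _ _ => rfl
  ext p
  simp only [Finset.mem_filter, Finset.mem_product]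
  constructor
  · rintro ⟨⟨h1, h2⟩, h3, h4⟩
    exact ⟨⟨⟨h1, h3⟩, h2.trans h4.symm⟩, h2⟩
  · rintro ⟨⟨⟨h1, h3⟩, h4⟩, h2⟩
    exact ⟨⟨h1, h2⟩, h3, h4 ▸ h2⟩

/-- folding inequality via reversibility. -/
theorem stmt14 (d : ℕ) (hd : 2 ≤ d) (ω : Config d) (n m : ℕ)
    (hn : 1 ≤ n) (hm : 1 ≤ m) :
    PWalk ω n (fun γ => visits γ = m) ^ 2 ≤
      2 * (d : ℝ) * (2 * (m : ℝ) + 1) ^ d *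
        PWalk ω (2 * n) (fun γ => visits γ ≤ 2 * m ∧ γ (Fin.last (2 * n)) = 0) := by
  classical
  set S := (finite_setOf_pathW_ne_zero ω n).toFinset.filter (fun γ => visits γ = m) with hS
  have hSmem : ∀ γ ∈ S, (γ 0 = 0 ∧ pathW ω γ ≠ 0) ∧ visits γ = m := by
    intro γ hγ
    rwa [hS, Finset.mem_filter, Set.Finite.mem_toFinset] at hγ
  set B : Finset (Zd d) := Fintype.piFinset fun _ => Finset.Icc (-(m : ℤ)) m with hB
  have hBcard : (B.card : ℝ) = (2 * (m : ℝ) + 1) ^ d := by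
    have : ((m : ℤ) + 1 - -(m : ℤ)).toNat = 2 * m + 1 := by omega
    rw [hB, Fintype.card_piFinset_const, Int.card_Icc, this]
    simp
  have hend : ∀ γ ∈ S, γ (Fin.last n) ∈ B := by
    intro γ hγ
    obtain ⟨⟨h0, hw⟩, hv⟩ := hSmem γ hγ
    rw [hB, Fintype.mem_piFinset]
    intro j
    rw [Finset.mem_Icc, ← abs_le, ← hv]
    exact abs_le_visits h0 hw _ j
  set P := {p ∈ S ×ˢ S | p.1 (Fin.last n) = p.2 (Fin.last n)} with hP
  have hPmem : ∀ p ∈ P, (p.1 ∈ S ∧ p.2 ∈ S) ∧ p.1 (Fin.last n) = p.2 (Fin.last n) := by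
    intro p hp
    rwa [hP, Finset.mem_filter, Finset.mem_product] at hp
  have hinj : Set.InjOn (fun p : (Fin (n + 1) → Zd d) × (Fin (n + 1) → Zd d) =>
      foldPath p.1 p.2) P := by
    intro p hp q hq hpq
    exact Prod.ext_iff.mpr (foldPath_injective (hPmem p hp).2 (hPmem q hq).2 hpq)
  have hfold : ∑ p ∈ P, pathW ω (foldPath p.1 p.2) ≤
      PWalk ω (2 * n) (fun γ => visits γ ≤ 2 * m ∧ γ (Fin.last (2 * n)) = 0) := by
    rw [← Finset.sum_image hinj]
    refine sum_pathW_le_PWalk ω _ _ fun γ hγ => ?_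
    obtain ⟨p, hp, rfl⟩ := Finset.mem_image.mp hγ
    obtain ⟨⟨h1, h2⟩, hlast⟩ := hPmem p hp
    have h1 := hSmem _ h1
    have h2 := hSmem _ h2
    have hv := visits_foldPath_le p.1 p.2
    exact ⟨(foldPath_zero _ _).trans h1.1.1, by omega,
      (foldPath_last hlast).trans h2.1.1⟩
  rw [PWalk_eq_sum]
  calc (∑ γ ∈ S, pathW ω γ) ^ 2
      ≤ (B.card : ℝ) * ∑ p ∈ P, pathW ω p.1 * pathW ω p.2 :=
        sq_sum_le_card_mul_sum_fiber S B (fun γ => γ (Fin.last n)) hend _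
    _ ≤ (B.card : ℝ) * ∑ p ∈ P, 2 * (d : ℝ) * pathW ω (foldPath p.1 p.2) := by
        refine mul_le_mul_of_nonneg_left (Finset.sum_le_sum fun p hp => ?_) (Nat.cast_nonneg _)
        exact pathW_mul_pathW_le ω hn (hPmem p hp).2
    _ = 2 * (d : ℝ) * (2 * (m : ℝ) + 1) ^ d * ∑ p ∈ P, pathW ω (foldPath p.1 p.2) := by
        rw [← Finset.mul_sum, hBcard]
        ring
    _ ≤ _ := by gcongr

end Perco
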